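/- Let S be a finite set of sources, each s ∈ S with a belief state <^s that is a modular, transitive relation on a finite set W, and let rank : S → R be a rank function into a linearly ordered set R. Define AGR(S) as the transitive closure of AGRRf(S). Then: (1) if all sources have equal rank (rank is constant on S), AGR(S) equals AGRUn(S), the transitive closure of ⋃_{s ∈ S} <^s; and (2) if rank is injective on S, AGR(S) equals AGRRf(S) (i.e., AGRRf(S) is already transitive). -/

import Mathlib

/-- The refinement aggregation `AGRRf(S)`: `x` is related to `y` iff some source
believes `x <^s y` and every strictly higher-ranked source is agnostic about `x, y`. -/
def AGRRf {W S R : Type*} [LinearOrder R] (b : S → W → W → Prop) (rank : S → R)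
    (x y : W) : Prop :=
  ∃ s : S, b s x y ∧ ∀ s' : S, rank s < rank s' → ¬ b s' x y ∧ ¬ b s' y x

/-- `AGR(S)`, the transitive closure of `AGRRf(S)`, reduces to `AGRUn(S)` when all
sources have equal rank, and to `AGRRf(S)` when the sources are strictly ranked. -/
theorem AGR_special_cases {W : Type*} [Fintype W] {S : Type*} [Fintype S]
    {R : Type*} [LinearOrder R] (b : S → W → W → Prop) (rank : S → R)
    (hmod : ∀ s, ∀ x y z : W, b s x y → b s x z ∨ b s z y)
    (htrans : ∀ s, ∀ x y z : W, b s x y → b s y z → b s x z) :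
    ((∀ s s' : S, rank s = rank s') →
      ∀ x y : W, Relation.TransGen (AGRRf b rank) x y ↔
        Relation.TransGen (fun u v => ∃ s, b s u v) x y) ∧
    (Function.Injective rank →
      ∀ x y : W, Relation.TransGen (AGRRf b rank) x y ↔ AGRRf b rank x y) := by
  constructor
  · intro h x y
    have key : AGRRf b rank = fun u v => ∃ s, b s u v := by
      funext u v
      apply propext
      constructor
      · rintro ⟨s, hs, _⟩
        exact ⟨s, hs⟩
      · rintro ⟨s, hs⟩
        exact ⟨s, hs, fun s' hlt => absurd (h s s') hlt.ne⟩
    rw [key]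
  · intro hinj x y
    have agn : ∀ s', ∀ x y z : W, (¬ b s' x y ∧ ¬ b s' y x) → (¬ b s' y z ∧ ¬ b s' z y) →
        (¬ b s' x z ∧ ¬ b s' z x) := by
      intro s' x y z h1 h2
      refine ⟨fun h => ?_, fun h => ?_⟩
      · exact (hmod s' x z y h).elim h1.1 h2.1
      · exact (hmod s' z x y h).elim h2.2 h1.2
    have tr : ∀ x y z : W, AGRRf b rank x y → AGRRf b rank y z → AGRRf b rank x z := by
      rintro x y z ⟨s, hs, hs'⟩ ⟨t, ht, ht'⟩
      rcases lt_trichotomy (rank s) (rank t) with h | h | h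
      · exact ⟨t, (hmod t y z x ht).resolve_left (hs' t h).2,
          fun u hu => agn u x y z (hs' u (h.trans hu)) (ht' u hu)⟩
      · obtain rfl := hinj h
        exact ⟨s, htrans s x y z hs ht, fun u hu => agn u x y z (hs' u hu) (ht' u hu)⟩
      · exact ⟨s, (hmod s x y z hs).resolve_right (ht' s h).2,
          fun u hu => agn u x y z (hs' u hu) (ht' u (h.trans hu))⟩
    constructor
    · intro h
      induction h with
      | single h => exact h
      | tail _ h ih => exact tr _ _ _ ih h
    · exact Relation.TransGen.single
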